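/- arXiv:2404.00109 — 3 statements merged into one kernel-verified Lean document; each statement's English description precedes it below -/
import Mathlib

section
/- Let f : ℝ^d → ℝ and g : ℝ^d → ℝ be continuously differentiable functions and let ℓ ∈ ℝ. Assume that for every feasible point x (i.e., every x with g(x) ≥ ℓ) one has ∇g(x) ≠ 0 and ∇f(x) ≠ 0, and assume that f attains its supremum over the feasible set {x ∈ ℝ^d : g(x) ≥ ℓ} at some point. Then the set of maximizers of f over {x ∈ ℝ^d : g(x) ≥ ℓ} coincides with the set of maximizers of f over the level set {x ∈ ℝ^d : g(x) = ℓ}. -/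
open scoped RealInnerProductSpace

/-- Proposition 1: under gradient non-vanishing on the feasible set and attainment of the
supremum, the maximizers of `f` over `{x | g x ≥ ℓ}` coincide with the maximizers of `f`
over the level set `{x | g x = ℓ}`. -/
theorem stmt_0 {d : ℕ} (f g : EuclideanSpace ℝ (Fin d) → ℝ) (ℓ : ℝ)
    (hf : ContDiff ℝ 1 f) (hg : ContDiff ℝ 1 g)
    (hgrad : ∀ x, ℓ ≤ g x → gradient g x ≠ 0 ∧ gradient f x ≠ 0)
    (hattain : ∃ x₀, ℓ ≤ g x₀ ∧ ∀ x, ℓ ≤ g x → f x ≤ f x₀) :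
    {x | ℓ ≤ g x ∧ ∀ y, ℓ ≤ g y → f y ≤ f x} =
      {x | g x = ℓ ∧ ∀ y, g y = ℓ → f y ≤ f x} := by
  have key : ∀ x, ℓ ≤ g x → (∀ y, ℓ ≤ g y → f y ≤ f x) → g x = ℓ := by
    intro x hx hmax
    by_contra hne
    have hlt : ℓ < g x := lt_of_le_of_ne hx (Ne.symm hne)
    have hloc : IsLocalMax f x := by
      filter_upwards [hg.continuous.continuousAt.eventually (lt_mem_nhds hlt)] with y hy
      exact hmax y hy.le
    apply (hgrad x hx).2
    simp [gradient, hloc.fderiv_eq_zero]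
  obtain ⟨x₀, h₀, hm₀⟩ := hattain
  ext x
  constructor
  · rintro ⟨hx, hmax⟩
    exact ⟨key x hx hmax, fun y hy => hmax y hy.ge⟩
  · rintro ⟨hx, hmax⟩
    exact ⟨hx.ge, fun y hy => (hm₀ y hy).trans (hmax x₀ (key x₀ h₀ hm₀))⟩
end

section
/- Let f : ℝ^d → ℝ and g : ℝ^d → ℝ be continuously differentiable and ℓ ∈ ℝ. Assume that for every x with g(x) ≥ ℓ one has ∇g(x) ≠ 0 and ∇f(x) ≠ 0, and that f attains its supremum over {x : g(x) ≥ ℓ}. Then sup{f(x) : g(x) ≥ ℓ} = sup{f(x) : g(x) = ℓ}, and the supremum on the right-hand side is attained. -/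
/-- Value form of Proposition 1: the optimal value of `f` over `{x | g x ≥ ℓ}` equals the
optimal value over the level set `{x | g x = ℓ}`, and the latter supremum is attained. -/
theorem stmt_10 {d : ℕ} (f g : EuclideanSpace ℝ (Fin d) → ℝ) (ℓ : ℝ)
    (hf : ContDiff ℝ 1 f) (hg : ContDiff ℝ 1 g)
    (hgrad : ∀ x, ℓ ≤ g x → gradient g x ≠ 0 ∧ gradient f x ≠ 0)
    (hattain : ∃ x₀, ℓ ≤ g x₀ ∧ ∀ x, ℓ ≤ g x → f x ≤ f x₀) :
    sSup (f '' {x | ℓ ≤ g x}) = sSup (f '' {x | g x = ℓ}) ∧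
      ∃ x, g x = ℓ ∧ f x = sSup (f '' {x | g x = ℓ}) := by
  obtain ⟨x₀, h0, hmax⟩ := hattain
  have heq : g x₀ = ℓ := by
    by_contra hne
    have hlt : ℓ < g x₀ := lt_of_le_of_ne h0 (Ne.symm hne)
    have hloc : IsLocalMax f x₀ := by
      filter_upwards [hg.continuous.continuousAt.eventually (lt_mem_nhds hlt)] with x hx
      exact hmax x (le_of_lt hx)
    apply (hgrad x₀ h0).2
    simp [gradient, hloc.fderiv_eq_zero]
  have h1 : IsGreatest (f '' {x | ℓ ≤ g x}) (f x₀) := by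
    refine ⟨⟨x₀, h0, rfl⟩, ?_⟩
    rintro _ ⟨x, hx, rfl⟩
    exact hmax x hx
  have h2 : IsGreatest (f '' {x | g x = ℓ}) (f x₀) := by
    refine ⟨⟨x₀, heq, rfl⟩, ?_⟩
    rintro _ ⟨x, hx, rfl⟩
    exact hmax x (le_of_eq (Eq.symm hx))
  rw [h1.csSup_eq, h2.csSup_eq]
  exact ⟨rfl, x₀, heq, rfl⟩
end

section
/- For all real α > 0 and β > 0, ∫_{−∞}^{∞} (1 + z/√(α + β + z²))^{α + 1/2} · (1 − z/√(α + β + z²))^{β + 1/2} dz = 2^{α+β−1} · B(α, β) · √(α + β), where B(α, β) = ∫_0^1 t^{α−1}(1−t)^{β−1} dt is the Beta function. -/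
open Real

lemma skew_r_pos {s : ℝ} (hs : 0 < s) (z : ℝ) : 0 < Real.sqrt (s + z ^ 2) :=
  Real.sqrt_pos.2 (by positivity)

lemma skew_ab {s : ℝ} (hs : 0 < s) (z : ℝ) :
    (1 + z / Real.sqrt (s + z ^ 2)) * (1 - z / Real.sqrt (s + z ^ 2)) =
      s / Real.sqrt (s + z ^ 2) ^ 2 := by
  have hr := skew_r_pos hs z
  have h2 : Real.sqrt (s + z ^ 2) ^ 2 = s + z ^ 2 := Real.sq_sqrt (by positivity)
  field_simp
  linarith

lemma skew_w {s : ℝ} (hs : 0 < s) (z : ℝ) :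
    0 < 1 + z / Real.sqrt (s + z ^ 2) ∧ 0 < 1 - z / Real.sqrt (s + z ^ 2) := by
  have hr := skew_r_pos hs z
  have h : |z| < Real.sqrt (s + z ^ 2) := by
    rw [← Real.sqrt_sq_eq_abs]
    exact Real.sqrt_lt_sqrt (by positivity) (by linarith)
  have h1 := abs_lt.1 h
  have e1 : z / Real.sqrt (s + z ^ 2) < 1 := by rw [div_lt_one hr]; exact h1.2
  have e2 : -1 < z / Real.sqrt (s + z ^ 2) := by rw [lt_div_iff₀ hr]; linarith [h1.1]
  constructor <;> linarith

lemma skew_deriv {s : ℝ} (hs : 0 < s) (z : ℝ) :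
    HasDerivAt (fun z : ℝ => (1 + z / Real.sqrt (s + z ^ 2)) / 2)
      (s / (2 * Real.sqrt (s + z ^ 2) ^ 3)) z := by
  have hr := skew_r_pos hs z
  have h2 : Real.sqrt (s + z ^ 2) ^ 2 = s + z ^ 2 := Real.sq_sqrt (by positivity)
  have h0 : HasDerivAt (fun z : ℝ => s + z ^ 2) (2 * z) z := by
    simpa using (hasDerivAt_pow 2 z).const_add s
  have h1 := h0.sqrt (by positivity)
  have h3 := (((hasDerivAt_id z).div h1 hr.ne').const_add 1).div_const 2
  refine h3.congr_deriv ?_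
  simp only [id]
  field_simp
  linarith

lemma skew_image {s : ℝ} (hs : 0 < s) :
    (fun z : ℝ => (1 + z / Real.sqrt (s + z ^ 2)) / 2) '' Set.univ = Set.Ioo 0 1 := by
  ext t
  simp only [Set.image_univ, Set.mem_range, Set.mem_Ioo]
  constructor
  · rintro ⟨z, rfl⟩
    have := skew_w hs z
    constructor <;> linarith [this.1, this.2]
  · rintro ⟨h0, h1⟩
    have hq : 0 < 1 - (2 * t - 1) ^ 2 := by nlinarith
    refine ⟨Real.sqrt (s / (1 - (2 * t - 1) ^ 2)) * (2 * t - 1), ?_⟩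
    have hd : 0 < Real.sqrt (s / (1 - (2 * t - 1) ^ 2)) := Real.sqrt_pos.2 (by positivity)
    have e : s + (Real.sqrt (s / (1 - (2 * t - 1) ^ 2)) * (2 * t - 1)) ^ 2 =
        s / (1 - (2 * t - 1) ^ 2) := by
      rw [mul_pow, Real.sq_sqrt (by positivity)]
      field_simp
      ring
    rw [e, mul_div_cancel_left₀ _ hd.ne']
    ring

lemma skew_point (α β : ℝ) {s : ℝ} (hs : 0 < s) (z : ℝ) :
    (1 + z / Real.sqrt (s + z ^ 2)) ^ (α + 1 / 2) *
        (1 - z / Real.sqrt (s + z ^ 2)) ^ (β + 1 / 2) =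
    ((2 : ℝ) ^ (α + β - 1) * Real.sqrt s) * (|s / (2 * Real.sqrt (s + z ^ 2) ^ 3)| •
      (((1 + z / Real.sqrt (s + z ^ 2)) / 2) ^ (α - 1) *
        (1 - (1 + z / Real.sqrt (s + z ^ 2)) / 2) ^ (β - 1))) := by
  have hr := skew_r_pos hs z
  obtain ⟨ha, hb⟩ := skew_w hs z
  have hab := skew_ab hs z
  have e0 : 1 - (1 + z / Real.sqrt (s + z ^ 2)) / 2 = (1 - z / Real.sqrt (s + z ^ 2)) / 2 := by
    ring
  rw [e0, abs_of_pos (by positivity), smul_eq_mul]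
  generalize Real.sqrt (s + z ^ 2) = r at *
  generalize 1 + z / r = a at *
  generalize 1 - z / r = b at *
  have hsq : Real.sqrt a * Real.sqrt b = Real.sqrt s / r := by
    rw [← Real.sqrt_mul ha.le, hab, Real.sqrt_div hs.le, Real.sqrt_sq hr.le]
  have ea : a ^ (α + 1 / 2) = a ^ (α - 1) * a * Real.sqrt a := by
    rw [Real.sqrt_eq_rpow, ← Real.rpow_add_one ha.ne', ← Real.rpow_add ha]; ring_nf
  have eb : b ^ (β + 1 / 2) = b ^ (β - 1) * b * Real.sqrt b := by
    rw [Real.sqrt_eq_rpow, ← Real.rpow_add_one hb.ne', ← Real.rpow_add hb]; ring_nf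
  have e2 : (2 : ℝ) ^ (α + β - 1) = 2 ^ (α - 1) * 2 ^ (β - 1) * 2 := by
    rw [← Real.rpow_add two_pos, ← Real.rpow_add_one two_ne_zero]; ring_nf
  rw [ea, eb, e2, Real.div_rpow ha.le two_pos.le, Real.div_rpow hb.le two_pos.le]
  have h1 : (2 : ℝ) ^ (α - 1) ≠ 0 := (Real.rpow_pos_of_pos two_pos _).ne'
  have h2 : (2 : ℝ) ^ (β - 1) ≠ 0 := (Real.rpow_pos_of_pos two_pos _).ne'
  calc _ = a ^ (α - 1) * b ^ (β - 1) * (a * b) * (Real.sqrt a * Real.sqrt b) := by ring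
    _ = _ := by
      rw [hab, hsq]
      field_simp

/-- Normalization of the Jones–Faddy skew-t density: the unnormalized density integrates to
`2^(α+β-1) · B(α, β) · √(α+β)`, where `B` is the Beta function. -/
theorem stmt_13 (α β : ℝ) (hα : 0 < α) (hβ : 0 < β) :
    (∫ z : ℝ, (1 + z / Real.sqrt (α + β + z ^ 2)) ^ (α + 1 / 2) *
        (1 - z / Real.sqrt (α + β + z ^ 2)) ^ (β + 1 / 2)) =
      (2 : ℝ) ^ (α + β - 1) *
        (∫ t in (0 : ℝ)..1, t ^ (α - 1) * (1 - t) ^ (β - 1)) *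
        Real.sqrt (α + β) := by
  have hs : 0 < α + β := by positivity
  have hinj : StrictMono (fun z : ℝ => (1 + z / Real.sqrt (α + β + z ^ 2)) / 2) := by
    apply strictMono_of_deriv_pos
    intro z
    rw [(skew_deriv hs z).deriv]
    have := skew_r_pos hs z
    positivity
  have key := MeasureTheory.integral_image_eq_integral_abs_deriv_smul MeasurableSet.univ
    (fun z _ => (skew_deriv hs z).hasDerivWithinAt) hinj.injective.injOn
    (fun t : ℝ => t ^ (α - 1) * (1 - t) ^ (β - 1))
  rw [skew_image hs, MeasureTheory.setIntegral_univ] at key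
  rw [intervalIntegral.integral_of_le zero_le_one, MeasureTheory.integral_Ioc_eq_integral_Ioo, key]
  simp_rw [skew_point α β hs]
  rw [MeasureTheory.integral_const_mul]
  ring
end
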